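/- For every integer j ≥ 1 and all pairwise distinct nonzero complex numbers x₁, …, x_j, y (with y nonzero and distinct from each xᵢ), the functions 𝒯_j satisfy the recursion 𝒯_{j+1}(x₁, …, x_j, y) = Σ_{i=1}^{j} [ (1/(y − xᵢ) − 1/y)·∂𝒯_j/∂xᵢ (x₁,…,x_j) + (2/(y − xᵢ)²)·𝒯_j(x₁,…,x_j) ] + (2/y²)·𝒯_j(x₁,…,x_j), with initial value 𝒯₁(x) = 1/x⁴. (In CFT language: the connected correlators ⟨T(x₁)⋯T(x_j)T(0)⟩_c with central charge c equal (c/2)·𝒯_j(x₁,…,x_j), and 𝒯_j is also the probability that a Brownian bubble rooted on the boundary intersects all j slits.) -/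

import Mathlib

open Complex

/-- The Brownian-bubble weight `𝒯_j(x₁,…,x_j) = Σ_{s ∈ S_j}
1/(x_{s(1)}² (x_{s(2)}-x_{s(1)})² ⋯ (x_{s(j)}-x_{s(j-1)})² x_{s(j)}²)`
(with the convention `TT 0 = 1`, unused below). -/
noncomputable def TT : (j : ℕ) → (Fin j → ℂ) → ℂ
  | 0, _ => 1
  | m + 1, x =>
      ∑ s : Equiv.Perm (Fin (m + 1)),
        1 / ((x (s 0)) ^ 2 *
          (∏ i : Fin m, (x (s i.succ) - x (s i.castSucc)) ^ 2) *
          (x (s (Fin.last m))) ^ 2)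

/-- The weight `1 / ((a₁ - b)² (a₂ - a₁)² ⋯ (aₙ - aₙ₋₁)² aₙ²)` of the path
`b → a₁ → ⋯ → aₙ → 0`. -/
noncomputable def pathWeight : (n : ℕ) → ℂ → (Fin n → ℂ) → ℂ
  | 0, b, _ => 1 / b ^ 2
  | n + 1, b, a => 1 / (a 0 - b) ^ 2 * pathWeight n (a 0) (fun i => a i.succ)

theorem pathWeight_succ_eq (m : ℕ) (b : ℂ) (a : Fin (m + 1) → ℂ) :
    pathWeight (m + 1) b a =
      1 / ((a 0 - b) ^ 2 * (∏ i : Fin m, (a i.succ - a i.castSucc) ^ 2) *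
        a (Fin.last m) ^ 2) := by
  induction m generalizing b with
  | zero => simp [pathWeight, mul_comm]
  | succ n ih =>
    rw [pathWeight, ih, Fin.prod_univ_succ]
    simp only [Fin.succ_zero_eq_one, Fin.castSucc_zero, Fin.succ_last, Fin.succ_castSucc,
      one_div, mul_inv]
    ring

theorem TT_succ_eq_sum_pathWeight (m : ℕ) (x : Fin (m + 1) → ℂ) :
    TT (m + 1) x = ∑ s : Equiv.Perm (Fin (m + 1)), pathWeight (m + 1) 0 (fun i => x (s i)) := by
  simp [TT, pathWeight_succ_eq]

theorem pathWeight_ne_zero (m : ℕ) (a : Fin (m + 1) → ℂ) (ha : Function.Injective a)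
    (h0 : ∀ i, a i ≠ 0) : pathWeight (m + 1) 0 a ≠ 0 := by
  rw [pathWeight_succ_eq, sub_zero]
  refine one_div_ne_zero (mul_ne_zero (mul_ne_zero (pow_ne_zero _ (h0 _)) ?_)
    (pow_ne_zero _ (h0 _)))
  refine Finset.prod_ne_zero_iff.mpr fun i _ => pow_ne_zero _ (sub_ne_zero.mpr ?_)
  exact ha.ne Fin.castSucc_lt_succ.ne'

theorem differentiableAt_pathWeight (m : ℕ) (a : Fin (m + 1) → ℂ)
    (h : pathWeight (m + 1) 0 a ≠ 0) :
    DifferentiableAt ℂ (pathWeight (m + 1) 0) a := by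
  rw [pathWeight_succ_eq] at h
  have hd := (div_ne_zero_iff.mp h).2
  have he : pathWeight (m + 1) 0 = fun a => 1 / ((a 0 - 0) ^ 2 *
      (∏ i : Fin m, (a i.succ - a i.castSucc) ^ 2) * a (Fin.last m) ^ 2) :=
    funext fun a => pathWeight_succ_eq m 0 a
  rw [he]
  fun_prop (disch := exact hd)

/-- The derivative of `pathWeight` along the vector field `z ↦ 1 / (y - z) - 1 / y` is given by
inserting `y` at each possible position of the path. -/
theorem hasDerivAt_pathWeight_add_mul (n : ℕ) (b y : ℂ) (a : Fin n → ℂ) (hy : y ≠ 0)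
    (hyb : y ≠ b) (hya : ∀ i, y ≠ a i) (h : pathWeight n b a ≠ 0) :
    HasDerivAt (fun t : ℂ => pathWeight n (b + t * (1 / (y - b) - 1 / y))
        (fun i => a i + t * (1 / (y - a i) - 1 / y)))
      (∑ p : Fin (n + 1), pathWeight (n + 1) b (p.insertNth y a) -
        (1 / y ^ 2 + 1 / (y - b) ^ 2 + ∑ i, 2 / (y - a i) ^ 2) * pathWeight n b a) 0 := by
  have hyb' := sub_ne_zero.mpr hyb
  induction n generalizing b with
  | zero =>
    have hb : b ≠ 0 := by
      rintro rfl
      simp [pathWeight] at h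
    have h1 : HasDerivAt (fun t : ℂ => b + t * (1 / (y - b) - 1 / y))
        (1 / (y - b) - 1 / y) 0 := by
      simpa using ((hasDerivAt_id (0 : ℂ)).mul_const (1 / (y - b) - 1 / y)).const_add b
    have h2 := (h1.fun_pow 2).fun_inv (by simpa using hb)
    refine (h2.congr_deriv ?_).congr_of_eventuallyEq
      (.of_forall fun t => by simp only [pathWeight, one_div])
    simp [pathWeight]
    field_simp
    ring
  | succ n ih =>
    have hab : a 0 - b ≠ 0 := by
      intro h'
      simp [pathWeight, h'] at h
    have hya0 := sub_ne_zero.mpr (hya 0)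
    have hF : pathWeight n (a 0) (fun i => a i.succ) ≠ 0 := by
      rw [pathWeight] at h
      exact right_ne_zero_of_mul h
    have hrec := ih (a 0) (fun i => a i.succ) (hya 0) (fun i => hya i.succ) hF hya0
    have h1 : HasDerivAt (fun t : ℂ => (a 0 + t * (1 / (y - a 0) - 1 / y)) -
        (b + t * (1 / (y - b) - 1 / y)))
        ((1 / (y - a 0) - 1 / y) - (1 / (y - b) - 1 / y)) 0 := by
      have key (c d : ℂ) : HasDerivAt (fun t : ℂ => c + t * d) d 0 := by
        simpa using ((hasDerivAt_id (0 : ℂ)).mul_const d).const_add c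
      exact (key _ _).sub (key _ _)
    have h2 := ((h1.fun_pow 2).fun_inv (by simpa using hab)).fun_mul hrec
    have hins (p : Fin (n + 1)) : pathWeight (n + 2) b (p.succ.insertNth y a) =
        1 / (a 0 - b) ^ 2 * pathWeight (n + 1) (a 0) (p.insertNth y fun i => a i.succ) := by
      have e : (p.succ.insertNth y a : Fin (n + 2) → ℂ) =
          Fin.cons (a 0) (p.insertNth y fun i => a i.succ) := by
        refine Fin.insertNth_eq_iff.mpr ⟨by simp, ?_⟩
        ext i
        refine Fin.cases ?_ (fun i => ?_) i <;> simp [Fin.removeNth]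
      rw [e, pathWeight]
      simp
    have hins0 : pathWeight (n + 2) b (Fin.insertNth 0 y a) =
        1 / (y - b) ^ 2 * (1 / (a 0 - y) ^ 2 * pathWeight n (a 0) (fun i => a i.succ)) := by
      simp [pathWeight]
    rw [Fin.sum_univ_succ, hins0, Finset.sum_congr rfl fun p _ => hins p, ← Finset.mul_sum,
      Fin.sum_univ_succ fun i => 2 / (y - a i) ^ 2, pathWeight]
    refine (h2.congr_deriv ?_).congr_of_eventuallyEq
      (.of_forall fun t => by simp only [pathWeight, one_div])
    simp only [zero_mul, add_zero]
    generalize ∑ p : Fin (n + 1), pathWeight (n + 1) (a 0) (p.insertNth y fun i => a i.succ) = S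
    generalize ∑ i : Fin n, 2 / (y - a i.succ) ^ 2 = R
    generalize pathWeight n (a 0) (fun i => a i.succ) = F
    have hay : a 0 - y ≠ 0 := sub_ne_zero.mpr (hya 0).symm
    rw [show (a 0 - y) = -(y - a 0) by ring]
    have hab' : a 0 - b = (y - b) - (y - a 0) := by ring
    rw [hab'] at hab ⊢
    generalize y - b = B at *
    generalize y - a 0 = A at *
    field_simp
    ring

/-- The permutation of `Fin (n + 1)` sending `p` to `Fin.last n` and acting as `s` elsewhere. -/
def insertLastPerm {n : ℕ} (p : Fin (n + 1)) (s : Equiv.Perm (Fin n)) :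
    Equiv.Perm (Fin (n + 1)) :=
  (finSuccEquiv' p).trans ((Equiv.optionCongr s).trans (finSuccEquiv' (Fin.last n)).symm)

@[simp]
theorem insertLastPerm_self {n : ℕ} (p : Fin (n + 1)) (s : Equiv.Perm (Fin n)) :
    insertLastPerm p s p = Fin.last n := by
  simp [insertLastPerm]

@[simp]
theorem insertLastPerm_succAbove {n : ℕ} (p : Fin (n + 1)) (s : Equiv.Perm (Fin n))
    (i : Fin n) : insertLastPerm p s (p.succAbove i) = (s i).castSucc := by
  simp [insertLastPerm]

theorem insertLastPerm_bijective (n : ℕ) :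
    Function.Bijective fun q : Fin (n + 1) × Equiv.Perm (Fin n) => insertLastPerm q.1 q.2 := by
  refine (Fintype.bijective_iff_injective_and_card _).mpr ⟨?_, ?_⟩
  · rintro ⟨p, s⟩ ⟨q, t⟩ h
    have hpq : p = q := by
      apply (insertLastPerm q t).injective
      rw [insertLastPerm_self, ← show insertLastPerm p s = insertLastPerm q t from h,
        insertLastPerm_self]
    subst hpq
    refine Prod.ext rfl (Equiv.ext fun i => ?_)
    have := congrArg (fun e : Equiv.Perm (Fin (n + 1)) => e (p.succAbove i)) h
    simpa using this
  · simp [Fintype.card_perm, Nat.factorial_succ]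

theorem TT_snoc (m : ℕ) (x : Fin (m + 1) → ℂ) (y : ℂ) :
    TT (m + 2) (Fin.snoc x y) = ∑ s : Equiv.Perm (Fin (m + 1)), ∑ p : Fin (m + 2),
      pathWeight (m + 2) 0 (p.insertNth y fun i => x (s i)) := by
  rw [TT_succ_eq_sum_pathWeight, ← (insertLastPerm_bijective (m + 1)).sum_comp,
    Fintype.sum_prod_type_right]
  refine Finset.sum_congr rfl fun s _ => Finset.sum_congr rfl fun p _ => ?_
  congr 1
  refine (Fin.insertNth_eq_iff.mpr ⟨by simp, ?_⟩).symm
  ext i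
  simp [Fin.removeNth]

theorem differentiableAt_TT (m : ℕ) (x : Fin (m + 1) → ℂ) (hx : Function.Injective x)
    (h0 : ∀ i, x i ≠ 0) : DifferentiableAt ℂ (TT (m + 1)) x := by
  rw [show TT (m + 1) = _ from funext (TT_succ_eq_sum_pathWeight m)]
  refine DifferentiableAt.fun_sum fun s _ => ?_
  have hs := differentiableAt_pathWeight m (fun i => x (s i))
    (pathWeight_ne_zero m _ (hx.comp s.injective) fun i => h0 _)
  exact DifferentiableAt.comp (f := fun (x : Fin (m + 1) → ℂ) i => x (s i)) x hs (by fun_prop)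

theorem hasDerivAt_add_mul_of_differentiableAt {ι : Type*} [Fintype ι] [DecidableEq ι]
    {f : (ι → ℂ) → ℂ} {x : ι → ℂ} (hf : DifferentiableAt ℂ f x) (v : ι → ℂ) :
    HasDerivAt (fun t : ℂ => f (fun i => x i + t * v i))
      (∑ i, v i * deriv (fun t => f (Function.update x i t)) (x i)) 0 := by
  have hd (i : ι) : deriv (fun t => f (Function.update x i t)) (x i) =
      fderiv ℂ f x (Pi.single i 1) := by
    refine HasDerivAt.deriv ?_
    have hf' : HasFDerivAt f (fderiv ℂ f x) (Function.update x i (x i)) := by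
      simpa using hf.hasFDerivAt
    exact hf'.comp_hasDerivAt (x i) (hasDerivAt_update x i (x i))
  have hline : HasDerivAt (fun (t : ℂ) (i : ι) => x i + t * v i) v 0 :=
    hasDerivAt_pi.mpr fun i => by
      simpa using ((hasDerivAt_id (0 : ℂ)).mul_const (v i)).const_add (x i)
  have hf' : HasFDerivAt f (fderiv ℂ f x) (fun i => x i + 0 * v i) := by
    simpa using hf.hasFDerivAt
  have h := hf'.comp_hasDerivAt (0 : ℂ) hline
  refine h.congr_deriv ?_
  have hv : v = ∑ i, v i • (Pi.single i 1 : ι → ℂ) := by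
    ext j
    simp [Finset.sum_apply, Pi.single_apply]
  conv_lhs => rw [hv, map_sum]
  refine Finset.sum_congr rfl fun i _ => ?_
  rw [hd, map_smul, smul_eq_mul]

/-- The functions `𝒯_j` have initial value `𝒯₁(x) = 1/x⁴` and satisfy the recursion
`𝒯_{j+1}(x₁,…,x_j,y) = Σᵢ [(1/(y-xᵢ) - 1/y)·∂𝒯_j/∂xᵢ + (2/(y-xᵢ)²)·𝒯_j] + (2/y²)·𝒯_j`
for pairwise distinct nonzero arguments. -/
theorem stmt13 :
    (∀ x : ℂ, TT 1 ![x] = 1 / x ^ 4) ∧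
    (∀ (m : ℕ) (x : Fin (m + 1) → ℂ) (y : ℂ),
      Function.Injective x → (∀ i, x i ≠ 0) → y ≠ 0 → (∀ i, y ≠ x i) →
      TT (m + 2) (Fin.snoc x y)
        = (∑ i : Fin (m + 1),
            ((1 / (y - x i) - 1 / y)
                * deriv (fun t => TT (m + 1) (Function.update x i t)) (x i)
              + 2 / (y - x i) ^ 2 * TT (m + 1) x))
          + 2 / y ^ 2 * TT (m + 1) x) := by
  refine ⟨fun x => ?_, fun m x y hx h0 hy hyx => ?_⟩
  · simp [TT]
    ring
  · have hpartial := hasDerivAt_add_mul_of_differentiableAt (differentiableAt_TT m x hx h0)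
      fun i => 1 / (y - x i) - 1 / y
    have hinsert := HasDerivAt.fun_sum (u := Finset.univ)
      fun (s : Equiv.Perm (Fin (m + 1))) _ =>
        hasDerivAt_pathWeight_add_mul (m + 1) 0 y (fun i => x (s i)) hy hy (fun i => hyx _)
          (pathWeight_ne_zero m _ (hx.comp s.injective) fun i => h0 _)
    simp only [sub_zero, sub_self, mul_zero, add_zero] at hinsert
    simp only [TT_succ_eq_sum_pathWeight m] at hpartial
    have heq := hpartial.unique hinsert
    have hperm (s : Equiv.Perm (Fin (m + 1))) :
        ∑ i, 2 / (y - x (s i)) ^ 2 = ∑ i, 2 / (y - x i) ^ 2 :=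
      Equiv.sum_comp s fun i => 2 / (y - x i) ^ 2
    simp only [hperm, Finset.sum_sub_distrib, ← Finset.mul_sum] at heq
    rw [← TT_snoc, ← TT_succ_eq_sum_pathWeight] at heq
    simp only [← TT_succ_eq_sum_pathWeight] at heq
    rw [Finset.sum_add_distrib, ← Finset.sum_mul, heq]
    ring
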